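/- Denominator bound for extremal rotation numbers: let w be a positive word in n letters whose last letter is the first generator, let s₁, …, sₙ ∈ ℚ, and write s₁ = p/q with p, q coprime integers and q > 0. If R_w(s₁,…,sₙ) is a rational number whose lowest-terms denominator is m > 0, then m ≤ q. -/

import Mathlib

open CircleDeg1Lift

/-- Translation number of an element of `Homeo_ℤ(ℝ) = CircleDeg1Liftˣ`. -/
noncomputable def tau (f : CircleDeg1Liftˣ) : ℝ :=
  translationNumber (f : CircleDeg1Lift)

/-- The set of translation numbers `τ(w(f₁,…,fₙ))` over all tuples `fᵢ ∈ Homeo_ℤ(ℝ)`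
with `τ(fᵢ) = sᵢ`. -/
def rotSet {n : ℕ} (w : FreeMonoid (Fin n)) (s : Fin n → ℝ) : Set ℝ :=
  {y | ∃ f : Fin n → CircleDeg1Liftˣ, (∀ i, tau (f i) = s i) ∧ y = tau (FreeMonoid.lift f w)}

/-- `R_w(s₁,…,sₙ) = sup { τ(w(f₁,…,fₙ)) : τ(fᵢ) = sᵢ }`. -/
noncomputable def Rw {n : ℕ} (w : FreeMonoid (Fin n)) (s : Fin n → ℝ) : ℝ :=
  sSup (rotSet w s)

/-- `LowerLimit u F`: the maps `u k` approach `F` from below, along arguments slightly to the left. -/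
def LowerLimit (u : ℕ → CircleDeg1Lift) (F : CircleDeg1Lift) : Prop :=
  ∀ x y, y < F x → ∃ x' < x, ∀ᶠ k in Filter.atTop, y < u k x'

theorem LowerLimit.const_of_continuous {f : CircleDeg1Lift} (hf : Continuous f) :
    LowerLimit (fun _ => f) f := by
  intro x y hy
  have h : ∀ᶠ z in nhdsWithin x (Set.Iio x), y < f z :=
    (hf.continuousAt.eventually (lt_mem_nhds hy)).filter_mono nhdsWithin_le_nhds
  obtain ⟨x', hx', hlt⟩ := (h.and self_mem_nhdsWithin).exists
  exact ⟨x', hlt, Filter.Eventually.of_forall fun _ => hx'⟩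

theorem LowerLimit.mul {u v : ℕ → CircleDeg1Lift} {F G : CircleDeg1Lift}
    (hu : LowerLimit u F) (hv : LowerLimit v G) : LowerLimit (fun k => u k * v k) (F * G) := by
  intro x y hy
  obtain ⟨z, hz, hzu⟩ := hu (G x) y hy
  obtain ⟨x', hx', hxv⟩ := hv x z hz
  refine ⟨x', hx', ?_⟩
  filter_upwards [hzu, hxv] with k hk hk'
  exact hk.trans_le ((u k).monotone hk'.le)

theorem LowerLimit.one : LowerLimit (fun _ => 1) 1 :=
  LowerLimit.const_of_continuous continuous_id

theorem LowerLimit.pow {u : ℕ → CircleDeg1Lift} {F : CircleDeg1Lift}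
    (hu : LowerLimit u F) (n : ℕ) : LowerLimit (fun k => u k ^ n) (F ^ n) := by
  induction n with
  | zero => simpa using LowerLimit.one
  | succ n ih => simpa [pow_succ] using ih.mul hu

theorem LowerLimit.lift {α : Type*} {u : ℕ → α → CircleDeg1Lift} {F : α → CircleDeg1Lift}
    (h : ∀ i, LowerLimit (fun k => u k i) (F i)) (w : FreeMonoid α) :
    LowerLimit (fun k => FreeMonoid.lift (u k) w) (FreeMonoid.lift F w) := by
  induction w using FreeMonoid.recOn with
  | one => simpa using LowerLimit.one
  | of_mul i w ih => simpa using (h i).mul ih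

theorem LowerLimit.translationNumber_le {u : ℕ → CircleDeg1Lift} {F : CircleDeg1Lift}
    (h : LowerLimit u F) {R : ℝ} (hR : ∀ k, translationNumber (u k) ≤ R) :
    translationNumber F ≤ R := by
  by_contra! hlt
  obtain ⟨N, hN⟩ := exists_nat_gt (3 / (translationNumber F - R))
  rw [div_lt_iff₀ (sub_pos.2 hlt)] at hN
  obtain ⟨x, hx, hk⟩ := h.pow N 0 ((F ^ N) 0 - 1) (by linarith)
  obtain ⟨k, hk⟩ := hk.exists
  have h₁ := (abs_le.1 (dist_pow_map_zero_mul_translationNumber_le (u k) N)).2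
  have h₂ := (abs_le.1 (dist_pow_map_zero_mul_translationNumber_le F N)).1
  have h₃ := (u k ^ N).monotone hx.le
  have h₄ := mul_le_mul_of_nonneg_left (hR k) (Nat.cast_nonneg (α := ℝ) N)
  linarith

theorem freeMonoid_lift_mono {α : Type*} {f g : α → CircleDeg1Lift} (h : ∀ i, f i ≤ g i)
    (w : FreeMonoid α) : FreeMonoid.lift f w ≤ FreeMonoid.lift g w := by
  induction w using FreeMonoid.recOn with
  | one => simp
  | of_mul i w ih =>
    intro x
    simp only [map_mul, FreeMonoid.lift_eval_of]
    exact ((f i).monotone (ih x)).trans (h i _)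

theorem coe_freeMonoid_lift {α : Type*} (f : α → CircleDeg1Liftˣ) (w : FreeMonoid α) :
    (FreeMonoid.lift f w : CircleDeg1Lift) = FreeMonoid.lift (fun i => (f i : CircleDeg1Lift)) w :=
  FreeMonoid.hom_map_lift (Units.coeHom CircleDeg1Lift) f w

theorem continuous_coe_units (f : CircleDeg1Liftˣ) : Continuous (f : CircleDeg1Lift) :=
  (toOrderIso f).continuous

theorem bddAbove_rotSet {n : ℕ} (w : FreeMonoid (Fin n)) (s : Fin n → ℝ) :
    BddAbove (rotSet w s) := by
  refine ⟨translationNumber (FreeMonoid.lift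
    (fun i => (translate (Multiplicative.ofAdd (s i + 1)) : CircleDeg1Lift)) w), ?_⟩
  rintro y ⟨f, hf, rfl⟩
  rw [tau, coe_freeMonoid_lift]
  refine translationNumber_mono (freeMonoid_lift_mono (fun i x => ?_) w)
  have h := map_lt_add_translationNumber_add_one (f i : CircleDeg1Lift) x
  have h' : translationNumber (f i : CircleDeg1Lift) = s i := hf i
  change _ ≤ (translate (Multiplicative.ofAdd (s i + 1)) : CircleDeg1Lift) x
  rw [translate_apply]
  linarith

theorem rotSet_nonempty {n : ℕ} (w : FreeMonoid (Fin n)) (s : Fin n → ℝ) :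
    (rotSet w s).Nonempty :=
  ⟨_, fun i => translate (Multiplicative.ofAdd (s i)),
    fun i => translationNumber_translate (s i), rfl⟩

/-- A closed set invariant under integer translations is the fixed set of a lift of a circle
homeomorphism moving all other points to the right. -/
theorem exists_unit_fixing {O : Set ℝ} (hO : IsClosed O) (hne : O.Nonempty)
    (hadd : ∀ x, x + 1 ∈ O ↔ x ∈ O) :
    ∃ h : CircleDeg1Liftˣ, (∀ x, x ≤ h x) ∧ ∀ x, h x = x ↔ x ∈ O := by
  have hinf : ∀ x, Metric.infDist (x + 1) O = Metric.infDist x O := by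
    intro x
    have himage : (IsometryEquiv.addRight (1 : ℝ)) '' O = O := by
      ext y
      constructor
      · rintro ⟨z, hz, rfl⟩
        exact (hadd z).2 hz
      · intro hy
        exact ⟨y - 1, (hadd _).1 (by simpa using hy), by simp⟩
    have := Metric.infDist_image (IsometryEquiv.addRight (1 : ℝ)).isometry (x := x) (t := O)
    rw [himage] at this
    simpa using this
  have hmono : StrictMono fun x => x + Metric.infDist x O / 2 := by
    intro x y hxy
    have h := Metric.infDist_le_infDist_add_dist (s := O) (x := x) (y := y)
    rw [Real.dist_eq, abs_of_neg (by linarith)] at h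
    simp only
    linarith
  let h : CircleDeg1Lift :=
    ⟨⟨fun x => x + Metric.infDist x O / 2, hmono.monotone⟩, fun x => by simp only [hinf]; ring⟩
  have hcont : Continuous h :=
    continuous_id.add ((Metric.continuous_infDist_pt O).div_const 2)
  obtain ⟨g, hg⟩ := isUnit_iff_bijective.2 ⟨hmono.injective, h.continuous_iff_surjective.1 hcont⟩
  have happ : ∀ x, g x = x + Metric.infDist x O / 2 := fun x => by rw [hg]; rfl
  refine ⟨g, fun x => ?_, fun x => ?_⟩
  · rw [happ]
    have := Metric.infDist_nonneg (x := x) (s := O)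
    linarith
  · rw [happ, hO.mem_iff_infDist_zero hne]
    constructor <;> intro <;> linarith

/-- If a lift `h` moves every point to the right, fixing exactly a nonempty set `O` invariant under
integer translations, then its powers approach a lift with values in `O`. -/
theorem exists_lowerLimit_pow {O : Set ℝ} (hne : O.Nonempty)
    (hadd : ∀ x, x + 1 ∈ O ↔ x ∈ O) (h : CircleDeg1Lift) (hcont : Continuous h)
    (hle : ∀ x, x ≤ h x) (hfix : ∀ x, h x = x ↔ x ∈ O) :
    ∃ F : CircleDeg1Lift, LowerLimit (fun k => h ^ k) F ∧ 1 ≤ F ∧ ∀ x, F x ∈ O := by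
  have hpow : ∀ x, Monotone fun k : ℕ => (h ^ k) x := fun x =>
    monotone_nat_of_le_succ fun k => by
      rw [pow_succ', CircleDeg1Lift.mul_apply]
      exact hle _
  have hbdd : ∀ x, BddAbove (Set.range fun k : ℕ => (h ^ k) x) := by
    intro x
    obtain ⟨o, ho⟩ := hne
    obtain ⟨m, hm⟩ := exists_nat_ge (x - o)
    have hom : ∀ m : ℕ, o + m ∈ O := by
      intro m
      induction m with
      | zero => simpa using ho
      | succ m ih => simpa [← add_assoc] using (hadd _).2 ih
    refine ⟨o + m, ?_⟩
    rintro _ ⟨k, rfl⟩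
    have hk : (h ^ k) (o + m) = o + m := by
      rw [CircleDeg1Lift.coe_pow]
      exact Function.iterate_fixed ((hfix _).2 (hom m)) k
    calc (h ^ k) x ≤ (h ^ k) (o + m) := (h ^ k).monotone (by linarith)
      _ = o + m := hk
  let F : CircleDeg1Lift :=
    ⟨⟨fun x => ⨆ k : ℕ, (h ^ k) x, fun x y hxy => ciSup_mono (hbdd y) fun k =>
      (h ^ k).monotone hxy⟩, fun x => by
        simp only [CircleDeg1Lift.map_add_one]
        exact (ciSup_add (hbdd x) 1).symm⟩
  have hF : ∀ x, F x = ⨆ k : ℕ, (h ^ k) x := fun _ => rfl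
  refine ⟨F, fun x y hy => ?_, fun x => le_ciSup (hbdd x) 0, fun x => ?_⟩
  · rw [hF] at hy
    obtain ⟨k, hk⟩ := exists_lt_of_lt_ciSup hy
    obtain ⟨x', hx', hev⟩ := LowerLimit.const_of_continuous (CircleDeg1Lift.continuous_pow _ hcont k) x y hk
    refine ⟨x', hx', ?_⟩
    filter_upwards [Filter.eventually_ge_atTop k] with j hj
    exact hev.exists.choose_spec.trans_le (hpow x' hj)
  · have ht : Filter.Tendsto (fun k : ℕ => (h ^ k) x) Filter.atTop (nhds (F x)) :=
      tendsto_atTop_ciSup (hpow x) (hbdd x)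
    rw [← hfix]
    refine tendsto_nhds_unique ((hcont.tendsto _).comp ht) ?_
    refine ((Filter.tendsto_add_atTop_iff_nat 1).2 ht).congr fun k => ?_
    rw [pow_succ', CircleDeg1Lift.mul_apply, Function.comp_apply]

/-- A lift with values in a union of `q` orbits of the integer translations has rational translation
number of denominator at most `q`. -/
theorem exists_translationNumber_eq_div {q : ℕ} (V : CircleDeg1Lift) (c : ℕ → ℝ)
    (hV : ∀ x, ∃ j < q, ∃ m : ℤ, V x = c j + m) :
    ∃ d ∈ Finset.Icc 1 q, ∃ m : ℤ, translationNumber V = m / d := by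
  choose j hj m hm using hV
  obtain ⟨a, ha, b, hb, hab, heq⟩ := Finset.exists_ne_map_eq_of_card_lt_of_maps_to
    (s := Finset.range (q + 1)) (t := Finset.range q) (f := fun i => j ((V ^ i) 0))
    (by simp) (fun i _ => by simpa using hj _)
  wlog hlt : a < b generalizing a b
  · exact this b hb a ha hab.symm heq.symm (by omega)
  simp only [Finset.mem_range] at ha hb
  refine ⟨b - a, Finset.mem_Icc.2 ⟨by omega, by omega⟩, m ((V ^ b) 0) - m ((V ^ a) 0), ?_⟩
  refine translationNumber_of_map_pow_eq_add_int V (x := (V ^ (a + 1)) 0) ?_ (by omega)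
  rw [← CircleDeg1Lift.mul_apply, ← pow_add, show b - a + (a + 1) = b + 1 by omega, pow_succ', pow_succ',
    CircleDeg1Lift.mul_apply, CircleDeg1Lift.mul_apply, hm, hm ((V ^ a) 0), ← heq]
  push_cast
  ring

theorem isClosed_setOf_div_le (q : ℕ) :
    IsClosed {x : ℝ | ∃ d ∈ Finset.Icc 1 q, ∃ m : ℤ, x = m / d} := by
  have : {x : ℝ | ∃ d ∈ Finset.Icc 1 q, ∃ m : ℤ, x = m / d} =
      ⋃ d ∈ Finset.Icc 1 q, Set.range fun m : ℤ => (m : ℝ) / d := by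
    ext x
    simp [eq_comm]
  rw [this]
  refine isClosed_biUnion_finset fun d hd => ?_
  have hd0 : (d : ℝ) ≠ 0 := by
    have := (Finset.mem_Icc.1 hd).1
    positivity
  have := (Homeomorph.mulRight₀ ((d : ℝ)⁻¹) (inv_ne_zero hd0)).isClosedEmbedding.comp
    Int.isClosedEmbedding_coe_real
  simpa [Function.comp_def, div_eq_mul_inv] using this.isClosed_range

/-- If `w` ends in the letter `0` and `s 0 = p / q`, then every element of `rotSet w s` is bounded
by a fraction of denominator at most `q` that does not exceed `Rw w s`. -/
theorem exists_div_between_rotSet_Rw {n : ℕ} (w : FreeMonoid (Fin (n + 1))) (s : Fin (n + 1) → ℝ)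
    (p : ℤ) {q : ℕ} (hq : 0 < q) (hs : s 0 = p / q) {y : ℝ}
    (hy : y ∈ rotSet (w * FreeMonoid.of 0) s) :
    ∃ L : ℝ, (∃ d ∈ Finset.Icc 1 q, ∃ m : ℤ, L = m / d) ∧
      y ≤ L ∧ L ≤ Rw (w * FreeMonoid.of 0) s := by
  obtain ⟨f, hf, rfl⟩ := hy
  have hf0 : translationNumber (f 0 : CircleDeg1Lift) = p / q := (hf 0).trans hs
  obtain ⟨x₀, hx₀⟩ := (translationNumber_eq_rat_iff _ (continuous_coe_units (f 0)) hq).1 hf0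
  set φ : CircleDeg1Lift := (f 0 : CircleDeg1Lift) with hφ
  let O : Set ℝ := {x | ∃ j < q, ∃ m : ℤ, x = (φ ^ j) x₀ + m}
  have hOclosed : IsClosed O := by
    have : O = ⋃ j ∈ Finset.range q, Set.range fun m : ℤ => (φ ^ j) x₀ + m := by
      ext x
      simp [O, eq_comm]
    rw [this]
    exact isClosed_biUnion_finset fun j _ =>
      ((Homeomorph.addLeft ((φ ^ j) x₀)).isClosedEmbedding.comp
        Int.isClosedEmbedding_coe_real).isClosed_range
  have hOne : O.Nonempty := ⟨x₀, 0, hq, 0, by simp⟩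
  have hOadd : ∀ x, x + 1 ∈ O ↔ x ∈ O := by
    intro x
    constructor
    · rintro ⟨j, hj, m, hm⟩
      exact ⟨j, hj, m - 1, by push_cast; linarith⟩
    · rintro ⟨j, hj, m, hm⟩
      exact ⟨j, hj, m + 1, by push_cast; linarith⟩
  have hOφ : ∀ x ∈ O, φ x ∈ O := by
    rintro x ⟨j, hj, m, rfl⟩
    rw [CircleDeg1Lift.map_add_int, ← CircleDeg1Lift.mul_apply, ← pow_succ']
    rcases (Nat.succ_le_of_lt hj).lt_or_eq with hlt | heq
    · exact ⟨j + 1, hlt, m, rfl⟩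
    · refine ⟨0, hq, p + m, ?_⟩
      rw [show j + 1 = q from heq, hx₀]
      simp [add_assoc]
  obtain ⟨h, hle, hfix⟩ := exists_unit_fixing hOclosed hOne hOadd
  obtain ⟨N, hlim, hone, hNO⟩ :=
    exists_lowerLimit_pow hOne hOadd h (continuous_coe_units h) hle hfix
  let g : ℕ → Fin (n + 1) → CircleDeg1Liftˣ := fun k => Function.update f 0 (f 0 * h ^ k)
  let F : Fin (n + 1) → CircleDeg1Lift := Function.update (fun i => (f i : CircleDeg1Lift)) 0 (φ * N)
  have hgτ : ∀ k i, tau (g k i) = s i := by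
    intro k i
    by_cases hi : i = 0
    · subst hi
      have hgO : ∀ x ∈ O, (g k 0 : CircleDeg1Lift) x = φ x := by
        intro x hx
        have : ((h : CircleDeg1Lift) ^ k) x = x := by
          rw [CircleDeg1Lift.coe_pow]
          exact Function.iterate_fixed ((hfix x).2 hx) k
        simp [g, hφ, this]
      have hmem : ∀ j, (φ ^ j) x₀ ∈ O := by
        intro j
        induction j with
        | zero => exact ⟨0, hq, 0, by simp⟩
        | succ j ih => rw [pow_succ', CircleDeg1Lift.mul_apply]; exact hOφ _ ih
      have hiter : ∀ j, ((g k 0 : CircleDeg1Lift) ^ j) x₀ = (φ ^ j) x₀ := by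
        intro j
        induction j with
        | zero => simp
        | succ j ih => rw [pow_succ', pow_succ', CircleDeg1Lift.mul_apply, CircleDeg1Lift.mul_apply, ih, hgO _ (hmem j)]
      rw [hs]
      exact translationNumber_of_map_pow_eq_add_int _ ((hiter q).trans hx₀) hq
    · simpa [g, hi] using hf i
  have hgF : ∀ i, LowerLimit (fun k => (g k i : CircleDeg1Lift)) (F i) := by
    intro i
    by_cases hi : i = 0
    · subst hi
      simpa [g, F] using (LowerLimit.const_of_continuous (continuous_coe_units (f 0))).mul hlim
    · simpa [g, F, hi] using LowerLimit.const_of_continuous (continuous_coe_units (f i))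
  have hfF : ∀ i, (f i : CircleDeg1Lift) ≤ F i := by
    intro i
    by_cases hi : i = 0
    · subst hi
      intro x
      simpa [F] using φ.monotone (hone x)
    · simp [F, hi]
  refine ⟨translationNumber (FreeMonoid.lift F (w * FreeMonoid.of 0)), ?_, ?_, ?_⟩
  · have hconj : SemiconjBy (F 0) (FreeMonoid.lift F (w * FreeMonoid.of 0))
        (F 0 * FreeMonoid.lift F w) := by
      simp [SemiconjBy, mul_assoc]
    rw [translationNumber_eq_of_semiconjBy hconj]
    refine exists_translationNumber_eq_div _ (fun j => (φ ^ j) x₀) fun x => ?_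
    have hx : (F 0 * FreeMonoid.lift F w) x = φ (N (FreeMonoid.lift F w x)) := by simp [F]
    rw [hx]
    exact hOφ _ (hNO _)
  · rw [tau, coe_freeMonoid_lift]
    exact translationNumber_mono (freeMonoid_lift_mono hfF _)
  · refine (LowerLimit.lift hgF _).translationNumber_le fun k => ?_
    exact le_csSup (bddAbove_rotSet _ s) ⟨g k, hgτ k, by rw [tau, coe_freeMonoid_lift]⟩

/-- Denominator bound for extremal rotation numbers: if the last letter of the positive
word `w` is the first generator, all `sᵢ` are rational, `s₁ = p/q` in lowest terms, and
`R_w(s₁,…,sₙ)` is a rational number `r` (whose lowest-terms denominator is `r.den`),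
then `r.den ≤ q`. -/
theorem Rw_denominator_bound {n : ℕ} (w w' : FreeMonoid (Fin (n + 1)))
    (hw : w = w' * FreeMonoid.of 0)
    (s : Fin (n + 1) → ℚ) (p q : ℤ) (hq : 0 < q) (hcop : Int.gcd p q = 1)
    (hs : (s 0 : ℚ) = (p : ℚ) / (q : ℚ))
    (r : ℚ) (hr : Rw w (fun i => (s i : ℝ)) = (r : ℝ)) :
    (r.den : ℤ) ≤ q := by
  lift q to ℕ using hq.le
  subst hw
  have hq' : 0 < q := by exact_mod_cast hq
  have hs' : ((s 0 : ℚ) : ℝ) = p / q := by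
    rw [hs]
    push_cast
    rfl
  have hmem : (r : ℝ) ∈ {x : ℝ | ∃ d ∈ Finset.Icc 1 q, ∃ m : ℤ, x = m / d} := by
    rw [← hr, ← (isClosed_setOf_div_le q).closure_eq, Metric.mem_closure_iff]
    intro ε hε
    obtain ⟨y, hy, hlt⟩ := exists_lt_of_lt_csSup
      (rotSet_nonempty (w' * FreeMonoid.of 0) (fun i => (s i : ℝ))) (sub_lt_self _ hε)
    obtain ⟨L, hL, hyL, hLR⟩ := exists_div_between_rotSet_Rw w' _ p hq' hs' hy
    refine ⟨L, hL, ?_⟩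
    rw [Real.dist_eq, abs_of_nonneg (sub_nonneg.2 hLR)]
    change Rw _ _ - ε < y at hlt
    linarith
  obtain ⟨d, hd, m, hm⟩ := hmem
  obtain ⟨hd1, hdq⟩ := Finset.mem_Icc.1 hd
  have hrm : r = (m : ℚ) / ((d : ℤ) : ℚ) := by
    have : (r : ℝ) = ((m / d : ℚ) : ℝ) := by rw [hm]; push_cast; rfl
    exact_mod_cast this
  have hdvd : (r.den : ℤ) ∣ d := by
    rw [hrm, ← Rat.divInt_eq_div]
    exact Rat.den_dvd m d
  exact (Int.le_of_dvd (by omega) hdvd).trans (by exact_mod_cast hdq)
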